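/- arXiv:2006.10000 — 2 statements merged into one kernel-verified Lean document; each statement's English description precedes it below -/
import Mathlib

section
/- Let 0 < k < n and let Λ ∈ ℝ^{k×k} be symmetric positive definite. Let E ∈ ℝ^{k×k}, F ∈ ℝ^{k×(n−k)}, G ∈ ℝ^{(n−k)×(n−k)}, R ∈ ℝ^{k×k}, S ∈ ℝ^{k×(n−k)}, V ∈ ℝ^{(n−k)×(n−k)}, and suppose the block identity diag(Λ, 0) · ( I_n + [E, F; F', G] · [R, S; S', V] ) = [R, S; S', V] holds. Then S = 0, V = 0, Λ + Λ E R = R, and R is invertible. -/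
open Matrix

/-- Let `Λ ≻ 0` of size `k` and suppose the block identity
`diag(Λ,0) (I + [E, F; Fᵀ, G] [R, S; Sᵀ, V]) = [R, S; Sᵀ, V]` holds.
Then `S = 0`, `V = 0`, `Λ + Λ E R = R`, and `R` is invertible. -/
theorem block_identity_consequences {k p : ℕ} (hk : 0 < k) (hp : 0 < p)
    (Λ E R : Matrix (Fin k) (Fin k) ℝ) (hΛ : Λ.PosDef)
    (F S : Matrix (Fin k) (Fin p) ℝ) (G V : Matrix (Fin p) (Fin p) ℝ)
    (h : fromBlocks Λ 0 0 0 *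
          (1 + fromBlocks E F Fᵀ G * fromBlocks R S Sᵀ V)
        = fromBlocks R S Sᵀ V) :
    S = 0 ∧ V = 0 ∧ Λ + Λ * E * R = R ∧ IsUnit R.det := by
  rw [← fromBlocks_one, fromBlocks_multiply, fromBlocks_add, fromBlocks_multiply,
    fromBlocks_inj] at h
  obtain ⟨hR, -, hS, hV⟩ := h
  have hS0 : S = 0 := by
    rw [← transpose_eq_zero, ← hS]
    simp
  have hV0 : V = 0 := by
    rw [← hV]
    simp
  have hΛR : Λ + Λ * E * R = R := by
    simpa [hS0, Matrix.mul_add, Matrix.mul_assoc] using hR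
  have hfactor : (1 - Λ * E) * R = Λ := by
    rw [Matrix.sub_mul, Matrix.one_mul]
    exact sub_eq_of_eq_add hΛR.symm
  refine ⟨hS0, hV0, hΛR, ?_⟩
  have hdet : IsUnit ((1 - Λ * E) * R).det := by
    rw [hfactor]
    exact hΛ.det_pos.ne'.isUnit
  rw [det_mul] at hdet
  exact isUnit_of_mul_isUnit_right hdet
end

section
/- Let P, R : ℝ → ℝ^{n×n} be functions that are continuous from the right at 0, let δ > 0, and suppose that for every t ∈ (0, δ) both P(t) and P(t)⁻¹ + R(t) are invertible, and that I + R(0)P(0) is invertible. Then (P(t)⁻¹ + R(t))⁻¹ converges, as t → 0 from the right, to P(0)(I + R(0)P(0))⁻¹. -/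
open Matrix Set Filter

/-- For invertible `P`, the inverse of `P⁻¹ + R` equals `P * (1 + R * P)⁻¹`. -/
theorem Matrix.inv_inv_add_eq_mul_inv {m K : Type*} [Fintype m] [DecidableEq m] [CommRing K]
    (P R : Matrix m m K) (hP : IsUnit P.det) :
    (P⁻¹ + R)⁻¹ = P * (1 + R * P)⁻¹ := by
  have h : P⁻¹ + R = (1 + R * P) * P⁻¹ := by
    rw [add_mul, one_mul, mul_assoc, mul_nonsing_inv P hP, mul_one]
  rw [h, mul_inv_rev, nonsing_inv_nonsing_inv P hP]

/-- If `P`, `R` are right-continuous at `0`, `P t` and `P t⁻¹ + R t` are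
invertible for `t ∈ (0, δ)`, and `I + R 0 · P 0` is invertible, then
`(P t⁻¹ + R t)⁻¹ → P 0 (I + R 0 · P 0)⁻¹` as `t → 0⁺`. -/
theorem limit_of_inverse_sum {n : ℕ} (P R : ℝ → Matrix (Fin n) (Fin n) ℝ)
    (hP : ContinuousWithinAt P (Ici 0) 0) (hR : ContinuousWithinAt R (Ici 0) 0)
    (δ : ℝ) (hδ : 0 < δ)
    (hinv : ∀ t ∈ Ioo 0 δ, IsUnit (P t).det ∧ IsUnit ((P t)⁻¹ + R t).det)
    (h0 : IsUnit (1 + R 0 * P 0).det) :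
    Tendsto (fun t => ((P t)⁻¹ + R t)⁻¹) (nhdsWithin 0 (Ioi 0))
      (nhds (P 0 * (1 + R 0 * P 0)⁻¹)) := by
  have hle : nhdsWithin (0 : ℝ) (Ioi 0) ≤ nhdsWithin 0 (Ici 0) :=
    nhdsWithin_mono 0 Ioi_subset_Ici_self
  have hP' : Tendsto P (nhdsWithin 0 (Ioi 0)) (nhds (P 0)) := hP.mono_left hle
  have hR' : Tendsto R (nhdsWithin 0 (Ioi 0)) (nhds (R 0)) := hR.mono_left hle
  have hsum : Tendsto (fun t => 1 + R t * P t) (nhdsWithin 0 (Ioi 0))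
      (nhds (1 + R 0 * P 0)) := (hR'.mul hP').const_add 1
  have hinverse : ContinuousAt Inv.inv (1 + R 0 * P 0) := by
    refine continuousAt_matrix_inv _ ?_
    rw [Ring.inverse_eq_inv']
    exact continuousAt_inv₀ h0.ne_zero
  refine (hP'.mul (hinverse.tendsto.comp hsum)).congr' ?_
  filter_upwards [Ioo_mem_nhdsGT hδ] with t ht
  exact (inv_inv_add_eq_mul_inv (P t) (R t) (hinv t ht).1).symm
end
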